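/- arXiv:1411.5460 — 2 statements merged into one kernel-verified Lean document; each statement's English description precedes it below -/
import Mathlib

section
/- Let C > 0 and define Φ'(y) = C·min(1, 1/y) for y > 0. Then for every x ∈ (0,1), with w := y + z − x, the double integral ∫₀^∞∫₀^∞ (min(√w,√x,√y,√z)/√x) · Φ'(w) Φ'(y) Φ'(z) · 1{y+z−x ≥ 0} dy dz is at most 11 C³. -/
open MeasureTheory Set Filter

/-- The kernel `min(√w,√x,√y,√z)/√x` appearing in the rescaled cubic term. -/
noncomputable def Wkern (w x y z : ℝ) : ℝ :=
  min (min (Real.sqrt w) (Real.sqrt x)) (min (Real.sqrt y) (Real.sqrt z)) / Real.sqrt x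

/-- The rescaled profile `Φ'(y) = C·min(1, 1/y)`. -/
noncomputable def Phi' (C y : ℝ) : ℝ := C * min 1 (1 / y)

lemma Wkern_nonneg (w x y z : ℝ) : 0 ≤ Wkern w x y z := by
  unfold Wkern; positivity

lemma Wkern_le_one (w x y z : ℝ) : Wkern w x y z ≤ 1 :=
  div_le_one_of_le₀ ((min_le_left _ _).trans (min_le_right _ _)) (Real.sqrt_nonneg x)

lemma Phi'_nonneg {C t : ℝ} (hC : 0 ≤ C) (ht : 0 ≤ t) : 0 ≤ Phi' C t := by
  unfold Phi'; positivity

lemma Phi'_le {C t b : ℝ} (hC : 0 ≤ C) (h : min 1 (1 / t) ≤ b) : Phi' C t ≤ C * b :=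
  mul_le_mul_of_nonneg_left h hC

/-- The cubic term without its kernel is a product of three profile bounds. -/
lemma cubic_term_le {C x y z a b c : ℝ} (hC : 0 ≤ C) (hy : 0 ≤ y) (hz : 0 ≤ z)
    (ha : 0 ≤ a) (hb : 0 ≤ b) (hc : 0 ≤ c)
    (hwa : 0 ≤ y + z - x → min 1 (1 / (y + z - x)) ≤ a)
    (hyb : min 1 (1 / y) ≤ b) (hzc : min 1 (1 / z) ≤ c) :
    (if 0 ≤ y + z - x then
        Wkern (y + z - x) x y z * Phi' C (y + z - x) * Phi' C y * Phi' C z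
      else 0) ≤ C ^ 3 * (a * b * c) := by
  split_ifs with hw
  · have := Phi'_nonneg hC hw
    have := Phi'_nonneg hC hy
    have := Phi'_nonneg hC hz
    calc _ ≤ 1 * (C * a) * (C * b) * (C * c) := by
          gcongr
          · exact Wkern_le_one _ _ _ _
          · exact Phi'_le hC (hwa hw)
          · exact Phi'_le hC hyb
          · exact Phi'_le hC hzc
      _ = _ := by ring
  · positivity

lemma cubic_term_nonneg {C x y z : ℝ} (hC : 0 ≤ C) (hy : 0 ≤ y) (hz : 0 ≤ z) :
    0 ≤ (if 0 ≤ y + z - x then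
        Wkern (y + z - x) x y z * Phi' C (y + z - x) * Phi' C y * Phi' C z
      else 0) := by
  split_ifs with hw
  · have := Phi'_nonneg hC hw
    have := Phi'_nonneg hC hy
    have := Phi'_nonneg hC hz
    have := Wkern_nonneg (y + z - x) x y z
    positivity
  · rfl

lemma integrableOn_Ioi_ite {a b : ℝ} (hab : a ≤ b) {f g : ℝ → ℝ}
    (hf : IntegrableOn f (Ioc a b)) (hg : IntegrableOn g (Ioi b)) :
    IntegrableOn (fun t => if t ≤ b then f t else g t) (Ioi a) := by
  rw [← Ioc_union_Ioi_eq_Ioi hab]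
  refine IntegrableOn.union (hf.congr_fun (fun t ht => ?_) measurableSet_Ioc)
    (hg.congr_fun (fun t ht => ?_) measurableSet_Ioi)
  · simp [ht.2]
  · simp [not_le.2 (mem_Ioi.1 ht)]

lemma integral_Ioi_ite {a b : ℝ} (hab : a ≤ b) {f g : ℝ → ℝ}
    (hf : IntegrableOn f (Ioc a b)) (hg : IntegrableOn g (Ioi b)) :
    ∫ t in Ioi a, (if t ≤ b then f t else g t) = (∫ t in Ioc a b, f t) + ∫ t in Ioi b, g t := by
  have h := integrableOn_Ioi_ite hab hf hg
  rw [← Ioc_union_Ioi_eq_Ioi hab] at h ⊢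
  rw [setIntegral_union (Ioc_disjoint_Ioi le_rfl) measurableSet_Ioi h.left_of_union
    h.right_of_union]
  congr 1
  · exact setIntegral_congr_fun measurableSet_Ioc fun t ht => by simp [ht.2]
  · exact setIntegral_congr_fun measurableSet_Ioi fun t ht => by simp [not_le.2 (mem_Ioi.1 ht)]

lemma min_one_inv_le_of_le {s t : ℝ} (hs : 0 < s) (h : s ≤ t) : min 1 (1 / t) ≤ 1 / s :=
  (min_le_right _ _).trans (one_div_le_one_div_of_le hs h)

lemma sqrt_mul_le_add_sub {x y z : ℝ} (hx : x ≤ 1) (hy : 2 ≤ y) (hz : 0 ≤ z) :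
    4 / 3 * (√y * √z) ≤ y + z - x := by
  have h1 := Real.sq_sqrt (show 0 ≤ y by linarith)
  have h2 := Real.sq_sqrt hz
  nlinarith [sq_nonneg (2 / 3 * √y - √z), sq_nonneg √y, sq_nonneg √z]

lemma rpow_neg_half {t : ℝ} (ht : 0 ≤ t) : t ^ (-(1 / 2) : ℝ) = 1 / √t := by
  rw [Real.rpow_neg ht, ← Real.sqrt_eq_rpow, one_div]

lemma rpow_neg_three_halves {t : ℝ} (ht : 0 < t) : t ^ (-(3 / 2) : ℝ) = 1 / √t * (1 / t) := by
  rw [← rpow_neg_half ht.le, one_div t, ← Real.rpow_neg_one t, ← Real.rpow_add ht]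
  norm_num

lemma inner_integral_le {C x y : ℝ} (hC : 0 ≤ C) (hx : x ≤ 1) (hy : 0 < y) :
    (∫ z in Ioi (0:ℝ), if 0 ≤ y + z - x then
        Wkern (y + z - x) x y z * Phi' C (y + z - x) * Phi' C y * Phi' C z
      else 0) ≤ C ^ 3 * 3 := by
  have hf : IntegrableOn (fun _ : ℝ => (1:ℝ)) (Ioc 0 2) := by simp
  have hg : IntegrableOn (fun z : ℝ => 2 * z ^ (-2 : ℝ)) (Ioi 2) :=
    (integrableOn_Ioi_rpow_of_lt (by norm_num) (by norm_num)).const_mul 2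
  have hI : ∫ z in Ioi (0:ℝ), (if z ≤ 2 then (1:ℝ) else 2 * z ^ (-2 : ℝ)) = 3 := by
    rw [integral_Ioi_ite (by norm_num) hf hg, integral_const_mul,
      integral_Ioi_rpow_of_lt (by norm_num) (by norm_num)]
    norm_num [Real.rpow_neg_one]
  rw [← hI, ← integral_const_mul]
  refine integral_mono_of_nonneg ?_ ((integrableOn_Ioi_ite (by norm_num) hf hg).const_mul _) ?_
  · exact (ae_restrict_iff' measurableSet_Ioi).2
      (.of_forall fun z hz => cubic_term_nonneg hC hy.le (le_of_lt hz))
  · refine (ae_restrict_iff' measurableSet_Ioi).2 (.of_forall fun z hz => ?_)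
    rw [mem_Ioi] at hz
    dsimp only
    rcases le_or_gt z 2 with h | h
    · rw [if_pos h]
      refine (cubic_term_le (x := x) (a := 1) (b := 1) (c := 1) hC hy.le hz.le zero_le_one
        zero_le_one zero_le_one (fun _ => min_le_left _ _) (min_le_left _ _)
        (min_le_left _ _)).trans_eq ?_
      ring
    · rw [if_neg h.not_ge]
      have e : 2 * z ^ (-2 : ℝ) = 1 / (z / 2) * 1 * (1 / z) := by
        rw [Real.rpow_neg hz.le, Real.rpow_two]; field_simp
      rw [e]
      exact cubic_term_le hC hy.le hz.le (by positivity) zero_le_one (by positivity)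
        (fun _ => min_one_inv_le_of_le (by positivity) (by linarith)) (min_le_left _ _)
        (min_le_right _ _)

lemma inner_integral_le_of_two_lt {C x y : ℝ} (hC : 0 ≤ C) (hx : x ≤ 1) (hy : 2 < y) :
    (∫ z in Ioi (0:ℝ), if 0 ≤ y + z - x then
        Wkern (y + z - x) x y z * Phi' C (y + z - x) * Phi' C y * Phi' C z
      else 0) ≤ C ^ 3 * (3 * y ^ (-(3 / 2) : ℝ)) := by
  have hy0 : 0 < y := by linarith
  have hi : IntervalIntegrable (fun z : ℝ => z ^ (-(1 / 2) : ℝ)) volume 0 1 :=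
    intervalIntegral.intervalIntegrable_rpow' (by norm_num)
  have hf : IntegrableOn (fun z : ℝ => z ^ (-(1 / 2) : ℝ)) (Ioc 0 1) :=
    (intervalIntegrable_iff_integrableOn_Ioc_of_le zero_le_one).1 hi
  have hg : IntegrableOn (fun z : ℝ => z ^ (-(3 / 2) : ℝ)) (Ioi 1) :=
    integrableOn_Ioi_rpow_of_lt (by norm_num) (by norm_num)
  have hI : ∫ z in Ioi (0:ℝ), (if z ≤ 1 then z ^ (-(1 / 2) : ℝ) else z ^ (-(3 / 2) : ℝ)) = 4 := by
    rw [integral_Ioi_ite zero_le_one hf hg, integral_Ioi_rpow_of_lt (by norm_num) (by norm_num),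
      ← intervalIntegral.integral_of_le zero_le_one, integral_rpow (.inl (by norm_num))]
    norm_num
  have e : C ^ 3 * (3 * y ^ (-(3 / 2) : ℝ)) = ∫ z in Ioi (0:ℝ), C ^ 3 * (3 / 4 * y ^ (-(3 / 2) : ℝ)) *
      (if z ≤ 1 then z ^ (-(1 / 2) : ℝ) else z ^ (-(3 / 2) : ℝ)) := by
    rw [integral_const_mul, hI]; ring
  rw [e]
  refine integral_mono_of_nonneg ?_ ((integrableOn_Ioi_ite zero_le_one hf hg).const_mul _) ?_
  · exact (ae_restrict_iff' measurableSet_Ioi).2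
      (.of_forall fun z hz => cubic_term_nonneg hC hy0.le (le_of_lt hz))
  · refine (ae_restrict_iff' measurableSet_Ioi).2 (.of_forall fun z hz => ?_)
    rw [mem_Ioi] at hz
    have hsy := Real.sqrt_pos.2 hy0
    have hsz := Real.sqrt_pos.2 hz
    have hw : 0 ≤ y + z - x → min 1 (1 / (y + z - x)) ≤ 1 / (4 / 3 * (√y * √z)) := fun _ =>
      min_one_inv_le_of_le (by positivity) (sqrt_mul_le_add_sub hx hy.le hz.le)
    dsimp only
    rw [rpow_neg_half hz.le, rpow_neg_three_halves hz, rpow_neg_three_halves hy0]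
    rcases le_or_gt z 1 with h | h
    · rw [if_pos h]
      refine (cubic_term_le hC hy0.le hz.le (by positivity) (by positivity) zero_le_one
        hw (min_le_right _ _) (min_le_left _ _)).trans_eq ?_
      field_simp
    · rw [if_neg h.not_ge]
      refine (cubic_term_le hC hy0.le hz.le (by positivity) (by positivity) (by positivity)
        hw (min_le_right _ _) (min_le_right _ _)).trans_eq ?_
      field_simp

/-- For every `C > 0` and `x ∈ (0,1)`, with `w := y + z − x`,
`∫₀^∞∫₀^∞ (min(√w,√x,√y,√z)/√x) Φ'(w) Φ'(y) Φ'(z) 1{y+z−x ≥ 0} dy dz ≤ 11 C³`. -/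
theorem rescaled_cubic_term_bound
    (C : ℝ) (hC : 0 < C) (x : ℝ) (hx : x ∈ Set.Ioo (0:ℝ) 1) :
    (∫ y in Set.Ioi (0:ℝ), ∫ z in Set.Ioi (0:ℝ),
      if 0 ≤ y + z - x then
        Wkern (y + z - x) x y z * Phi' C (y + z - x) * Phi' C y * Phi' C z
      else 0) ≤ 11 * C ^ 3 := by
  have hf : IntegrableOn (fun _ : ℝ => (3:ℝ)) (Ioc 0 2) := by simp
  have hg : IntegrableOn (fun y : ℝ => 3 * y ^ (-(3 / 2) : ℝ)) (Ioi 2) :=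
    (integrableOn_Ioi_rpow_of_lt (by norm_num) (by norm_num)).const_mul 3
  have hI : ∫ y in Ioi (0:ℝ), (if y ≤ 2 then (3:ℝ) else 3 * y ^ (-(3 / 2) : ℝ)) ≤ 11 := by
    rw [integral_Ioi_ite (by norm_num) hf hg, integral_const_mul,
      integral_Ioi_rpow_of_lt (by norm_num) (by norm_num),
      show (-(3 / 2) + 1 : ℝ) = -(1 / 2) by norm_num, rpow_neg_half (by norm_num)]
    have h2 : 1 / √2 ≤ (5 / 6 : ℝ) := by
      rw [div_le_iff₀ (by positivity)]
      nlinarith [Real.sq_sqrt (show (0:ℝ) ≤ 2 by norm_num), Real.sqrt_nonneg 2]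
    simp only [integral_const, measureReal_restrict_apply_univ, Real.volume_real_Ioc, smul_eq_mul]
    norm_num at h2 ⊢
    linarith
  calc _ ≤ ∫ y in Ioi (0:ℝ), C ^ 3 * (if y ≤ 2 then (3:ℝ) else 3 * y ^ (-(3 / 2) : ℝ)) := by
        refine integral_mono_of_nonneg ?_
          ((integrableOn_Ioi_ite (by norm_num) hf hg).const_mul _) ?_
        · exact (ae_restrict_iff' measurableSet_Ioi).2 (.of_forall fun y hy =>
            setIntegral_nonneg measurableSet_Ioi fun z hz =>
              cubic_term_nonneg hC.le (le_of_lt hy) (le_of_lt hz))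
        · refine (ae_restrict_iff' measurableSet_Ioi).2 (.of_forall fun y hy => ?_)
          dsimp only
          split_ifs with h
          · exact inner_integral_le hC.le hx.2.le hy
          · exact inner_integral_le_of_two_lt hC.le hx.2.le (not_le.1 h)
    _ ≤ 11 * C ^ 3 := by
        rw [integral_const_mul, mul_comm]
        gcongr
end

section
/- For every β > 0 and κ > 0, the set G^β_κ is weakly sequentially compact: every sequence (μ_j) of measures in G^β_κ has a subsequence that converges weakly (i.e., the integrals of every bounded continuous function on ℝ₊ converge) to a measure μ, and this limit μ again belongs to G^β_κ. -/
open MeasureTheory Set Filter Topology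

/-- The exponentially weighted local norm
`‖μ‖_{G^β} = sup_{R ≥ 0} ∫_{[R,R+1)} e^{βx} μ(dx)` (valued in `ℝ≥0∞`). -/
noncomputable def Gnorm (β : ℝ) (μ : Measure ℝ) : ENNReal :=
  ⨆ R : {r : ℝ // 0 ≤ r},
    ∫⁻ x in Set.Ico (R : ℝ) ((R : ℝ) + 1), ENNReal.ofReal (Real.exp (β * x)) ∂μ

/-- Membership in `G^β_κ`: a nonnegative measure on `ℝ₊ = [0,∞)` (no mass on `(-∞,0)`)
whose exponentially weighted local norm is at most `κ`. -/
def MemG (β κ : ℝ) (μ : Measure ℝ) : Prop :=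
  μ (Set.Iio 0) = 0 ∧ Gnorm β μ ≤ ENNReal.ofReal κ

open scoped NNReal ENNReal BoundedContinuousFunction

/-- Prokhorov's theorem in sequential form, for measures on the half-line with uniformly bounded
mass and uniformly small tails. -/
theorem exists_subseq_tendsto_integral_of_measure_Ici_le {μ : ℕ → Measure ℝ} {C : ℝ≥0}
    {u : ℕ → ℝ≥0} (hC : 0 < C) (hu : Tendsto u atTop (𝓝 0)) (hneg : ∀ j, μ j (Iio 0) = 0)
    (hmass : ∀ j, μ j univ ≤ C) (htail : ∀ j (n : ℕ), μ j (Ici (n : ℝ)) ≤ C * u n) :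
    ∃ (ν : Measure ℝ) (g : ℕ → ℕ), StrictMono g ∧ IsFiniteMeasure ν ∧ ν (Iio 0) = 0 ∧
      ∀ φ : ℝ →ᵇ ℝ, Tendsto (fun n => ∫ x, φ x ∂(μ (g n))) atTop (𝓝 (∫ x, φ x ∂ν)) := by
  have hC0 : (C : ℝ≥0∞) ≠ 0 := by simpa using hC.ne'
  have hfin : ∀ j, IsFiniteMeasure (μ j) := fun j => ⟨(hmass j).trans_lt ENNReal.coe_lt_top⟩
  -- Complete `μ j` to total mass `C` with an atom at `-1`, then normalise.
  let P : ℕ → Measure ℝ := fun j =>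
    (C : ℝ≥0∞)⁻¹ • (μ j + ((C : ℝ≥0∞) - μ j univ) • Measure.dirac (-1))
  have hP : ∀ j, IsProbabilityMeasure (P j) := fun j => ⟨by
    simp only [P, Measure.smul_apply, Measure.add_apply, measure_univ, smul_eq_mul, mul_one]
    rw [add_tsub_cancel_of_le (hmass j), ENNReal.inv_mul_cancel hC0 ENNReal.coe_ne_top]⟩
  let Q : ℕ → ProbabilityMeasure ℝ := fun j => ⟨P j, hP j⟩
  have hQ : ∀ j, (Q j : Measure ℝ) = P j := fun j => rfl
  have hcompact := isCompact_setOfPred_probabilityMeasure_mass_eq_compl_isCompact_le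
    (K := fun n : ℕ => Icc (-1 : ℝ) n) hu (fun n => isCompact_Icc) (Or.inl inferInstance)
  have hmem : ∀ j, Q j ∈
      {ρ : ProbabilityMeasure ℝ | ∀ n : ℕ, ρ (Icc (-1 : ℝ) n)ᶜ ≤ u n} := by
    intro j n
    rw [← ENNReal.coe_le_coe, ProbabilityMeasure.ennreal_coeFn_eq_coeFn_toMeasure, hQ]
    have hle : μ j (Icc (-1 : ℝ) n)ᶜ ≤ C * u n := by
      calc μ j (Icc (-1 : ℝ) n)ᶜ ≤ μ j (Iio 0 ∪ Ici (n : ℝ)) := by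
            refine measure_mono fun x hx => ?_
            by_contra hx'
            simp only [mem_union, mem_Iio, mem_Ici, not_or, not_lt, not_le] at hx'
            exact hx ⟨by linarith, hx'.2.le⟩
        _ ≤ μ j (Iio 0) + μ j (Ici (n : ℝ)) := measure_union_le _ _
        _ ≤ C * u n := by rw [hneg, zero_add]; exact htail j n
    have hdirac : Measure.dirac (-1 : ℝ) (Icc (-1 : ℝ) n)ᶜ = 0 := by
      rw [Measure.dirac_apply' _ measurableSet_Icc.compl]
      have : (-1 : ℝ) ≤ n := by linarith [n.cast_nonneg (α := ℝ)]
      simp [this]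
    calc P j (Icc (-1 : ℝ) n)ᶜ = (C : ℝ≥0∞)⁻¹ * μ j (Icc (-1 : ℝ) n)ᶜ := by simp [P, hdirac]
      _ ≤ (C : ℝ≥0∞)⁻¹ * (C * u n) := by gcongr
      _ = u n := by rw [← mul_assoc, ENNReal.inv_mul_cancel hC0 ENNReal.coe_ne_top, one_mul]
  obtain ⟨ρ, -, g, hg, hlim⟩ := hcompact.tendsto_subseq hmem
  have hρ := ProbabilityMeasure.tendsto_iff_forall_integral_tendsto.1 hlim
  have hgap : (ρ : Measure ℝ) (Ioo (-1) 0) = 0 := by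
    have h := ProbabilityMeasure.le_liminf_measure_open_of_tendsto hlim
      (isOpen_Ioo (a := (-1 : ℝ)) (b := 0))
    have hz : ∀ j, P j (Ioo (-1) 0) = 0 := fun j => by
      have : μ j (Ioo (-1) 0) = 0 := measure_mono_null Ioo_subset_Iio_self (hneg j)
      simp [P, this]
    simpa [hQ, hz] using h
  refine ⟨(C : ℝ≥0∞) • (ρ : Measure ℝ).restrict (Ici 0), g, hg, ?_, ?_, fun φ => ?_⟩
  · exact Measure.smul_finite _ ENNReal.coe_ne_top
  · rw [Measure.smul_apply, Measure.restrict_apply measurableSet_Iio]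
    simp [Iio_inter_Ici]
  let χ : ℝ → ℝ := fun x => max 0 (min 1 (x + 1))
  have hχ1 : ∀ x, 0 ≤ x → χ x = 1 := fun x hx => by simp [χ, hx]
  have hχ0 : ∀ x, x ≤ -1 → χ x = 0 := fun x hx =>
    max_eq_left ((min_le_right _ _).trans (by linarith))
  let ψ : ℝ →ᵇ ℝ := BoundedContinuousFunction.ofNormedAddCommGroup (fun x => χ x * φ x)
    (by fun_prop) ‖φ‖ fun x => by
      have h0 : 0 ≤ χ x := le_max_left _ _
      have h1 : χ x ≤ 1 := max_le zero_le_one (min_le_left _ _)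
      rw [norm_mul, Real.norm_of_nonneg h0]
      exact (mul_le_of_le_one_left (norm_nonneg _) h1).trans (φ.norm_coe_le_norm x)
  have hψ : ∀ x, ψ x = χ x * φ x := fun x => rfl
  have hPψ : ∀ j, (C : ℝ) * ∫ x, ψ x ∂(P j) = ∫ x, φ x ∂(μ j) := by
    intro j
    have hμψ : ∫ x, ψ x ∂(μ j) = ∫ x, φ x ∂(μ j) := by
      refine integral_congr_ae ?_
      have : ∀ᵐ x ∂(μ j), x ∉ Iio (0 : ℝ) := measure_eq_zero_iff_ae_notMem.1 (hneg j)
      filter_upwards [this] with x hx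
      rw [hψ, hχ1 x (not_lt.1 hx), one_mul]
    have hd : IsFiniteMeasure (((C : ℝ≥0∞) - μ j univ) • Measure.dirac (-1 : ℝ)) :=
      Measure.smul_finite _ (ENNReal.sub_ne_top ENNReal.coe_ne_top)
    rw [integral_smul_measure, integral_add_measure (ψ.integrable _) (ψ.integrable _),
      integral_smul_measure, integral_dirac, hψ (-1), hχ0 _ le_rfl, hμψ]
    simp [hC.ne']
  have hρψ : (C : ℝ) * ∫ x, ψ x ∂(ρ : Measure ℝ) =
      ∫ x, φ x ∂((C : ℝ≥0∞) • (ρ : Measure ℝ).restrict (Ici 0)) := by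
    rw [integral_smul_measure, ← integral_indicator measurableSet_Ici]
    simp only [ENNReal.coe_toReal, smul_eq_mul]
    congr 1
    refine integral_congr_ae ?_
    filter_upwards [measure_eq_zero_iff_ae_notMem.1 hgap] with x hx
    rw [hψ]
    rcases le_or_gt 0 x with h | h
    · simp [hχ1 x h, h]
    · have : x ≤ -1 := by
        by_contra hlt
        exact hx ⟨not_le.1 hlt, h⟩
      simp [hχ0 x this, h]
  rw [← hρψ]
  simpa only [← hPψ] using! (hρ ψ).const_mul (C : ℝ)

theorem MemG.setLIntegral_le {β κ : ℝ} {μ : Measure ℝ} (hμ : MemG β κ μ) {R : ℝ} (hR : 0 ≤ R) :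
    ∫⁻ x in Ico R (R + 1), ENNReal.ofReal (Real.exp (β * x)) ∂μ ≤ ENNReal.ofReal κ :=
  (le_iSup (fun R : {r : ℝ // 0 ≤ r} => ∫⁻ x in Ico (R : ℝ) ((R : ℝ) + 1),
    ENNReal.ofReal (Real.exp (β * x)) ∂μ) ⟨R, hR⟩).trans hμ.2

theorem MemG.measure_Ico_le {β κ : ℝ} {μ : Measure ℝ} (hβ : 0 ≤ β) (hμ : MemG β κ μ) (n : ℕ) :
    μ (Ico (n : ℝ) (n + 1)) ≤ ENNReal.ofReal κ * ENNReal.ofReal (Real.exp (-β)) ^ n := by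
  have hexp : ENNReal.ofReal (Real.exp (-β)) ^ n * ENNReal.ofReal (Real.exp (β * n)) = 1 := by
    rw [← ENNReal.ofReal_pow (Real.exp_nonneg _), ← Real.exp_nat_mul,
      ← ENNReal.ofReal_mul (Real.exp_nonneg _), ← Real.exp_add]
    ring_nf
    simp
  have h : ENNReal.ofReal (Real.exp (β * n)) * μ (Ico (n : ℝ) (n + 1)) ≤ ENNReal.ofReal κ := by
    refine le_trans ?_ (hμ.setLIntegral_le n.cast_nonneg)
    rw [← setLIntegral_const]
    refine setLIntegral_mono' measurableSet_Ico fun x hx => ?_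
    gcongr
    exact hx.1
  calc μ (Ico (n : ℝ) (n + 1))
      = ENNReal.ofReal (Real.exp (-β)) ^ n *
          (ENNReal.ofReal (Real.exp (β * n)) * μ (Ico (n : ℝ) (n + 1))) := by
        rw [← mul_assoc, hexp, one_mul]
    _ ≤ ENNReal.ofReal κ * ENNReal.ofReal (Real.exp (-β)) ^ n := by
        rw [mul_comm (ENNReal.ofReal κ)]
        gcongr

theorem MemG.measure_Ici_le {β κ : ℝ} {μ : Measure ℝ} (hβ : 0 ≤ β) (hμ : MemG β κ μ) (n : ℕ) :
    μ (Ici (n : ℝ)) ≤ ENNReal.ofReal κ * (1 - ENNReal.ofReal (Real.exp (-β)))⁻¹ *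
      ENNReal.ofReal (Real.exp (-β)) ^ n := by
  have hcover : Ici (n : ℝ) ⊆ ⋃ i : ℕ, Ico ((n + i : ℕ) : ℝ) ((n + i : ℕ) + 1) := by
    intro x hx
    have hx0 : 0 ≤ x := n.cast_nonneg.trans hx
    obtain ⟨i, hi⟩ := Nat.exists_eq_add_of_le (Nat.le_floor (mem_Ici.1 hx))
    refine mem_iUnion.2 ⟨i, ?_⟩
    rw [← hi]
    exact ⟨Nat.floor_le hx0, Nat.lt_floor_add_one x⟩
  calc μ (Ici (n : ℝ)) ≤ ∑' i : ℕ, μ (Ico ((n + i : ℕ) : ℝ) ((n + i : ℕ) + 1)) :=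
        (measure_mono hcover).trans (measure_iUnion_le _)
    _ ≤ ∑' i : ℕ, ENNReal.ofReal κ * ENNReal.ofReal (Real.exp (-β)) ^ (n + i) :=
        ENNReal.tsum_le_tsum fun i => hμ.measure_Ico_le hβ (n + i)
    _ = _ := by
        simp_rw [pow_add]
        rw [ENNReal.tsum_mul_left, ENNReal.tsum_mul_left, ENNReal.tsum_geometric]
        ring

/-- A continuous cutoff with values in `[0, 1]`, supported in `[R - 1/n, R + 1 - 1/n]`. -/
noncomputable def cutoff (R : ℝ) (n : ℕ) (x : ℝ) : ℝ :=
  max 0 (min 1 (n * (R + 1 - x) - 1)) * max 0 (min 1 (1 + n * (x - R)))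

theorem continuous_cutoff (R : ℝ) (n : ℕ) : Continuous (cutoff R n) := by
  unfold cutoff
  fun_prop

theorem cutoff_nonneg (R : ℝ) (n : ℕ) (x : ℝ) : 0 ≤ cutoff R n x :=
  mul_nonneg (le_max_left _ _) (le_max_left _ _)

theorem cutoff_le_one (R : ℝ) (n : ℕ) (x : ℝ) : cutoff R n x ≤ 1 :=
  mul_le_one₀ (max_le zero_le_one (min_le_left _ _)) (le_max_left _ _)
    (max_le zero_le_one (min_le_left _ _))

theorem cutoff_eq_zero_of_le {R x : ℝ} {n : ℕ} (h : 1 + n * (x - R) ≤ 0) :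
    cutoff R n x = 0 := by
  rw [cutoff, max_eq_left ((min_le_right 1 (1 + n * (x - R))).trans h), mul_zero]

theorem cutoff_eq_zero_of_ge {R x : ℝ} {n : ℕ} (h : n * (R + 1 - x) - 1 ≤ 0) :
    cutoff R n x = 0 := by
  rw [cutoff, max_eq_left ((min_le_right 1 (n * (R + 1 - x) - 1)).trans h), zero_mul]

theorem eventually_cutoff_eq_one {R x : ℝ} (hx : x ∈ Ico R (R + 1)) :
    ∀ᶠ n : ℕ in atTop, cutoff R n x = 1 := by
  have hpos : 0 < R + 1 - x := by linarith [hx.2]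
  filter_upwards [(tendsto_natCast_atTop_atTop.atTop_mul_const hpos).eventually_ge_atTop (2 : ℝ)]
    with n hn
  have h2 : (0 : ℝ) ≤ n * (x - R) := mul_nonneg n.cast_nonneg (sub_nonneg.2 hx.1)
  rw [cutoff, min_eq_left (by linarith), min_eq_left (by linarith)]
  simp

theorem MemG.lintegral_cutoff_mul_exp_le {β κ : ℝ} {μ : Measure ℝ} (hμ : MemG β κ μ)
    {R : ℝ} {n : ℕ} (hn : 0 < n) :
    ∫⁻ x, ENNReal.ofReal (cutoff R n x * Real.exp (β * min x (R + 1))) ∂μ ≤ ENNReal.ofReal κ := by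
  have hn' : (0 : ℝ) < n := by exact_mod_cast hn
  have hinv : (n : ℝ) * (n : ℝ)⁻¹ = 1 := mul_inv_cancel₀ hn'.ne'
  have hinv' : (0 : ℝ) < (n : ℝ)⁻¹ := inv_pos.2 hn'
  set S := max 0 (R - (n : ℝ)⁻¹) with hS
  refine le_trans ?_ (hμ.setLIntegral_le (le_max_left 0 (R - (n : ℝ)⁻¹)))
  rw [← lintegral_indicator measurableSet_Ico]
  refine lintegral_mono_ae ?_
  filter_upwards [measure_eq_zero_iff_ae_notMem.1 hμ.1] with x hx
  have hx0 : 0 ≤ x := not_lt.1 hx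
  by_cases hmem : x ∈ Ico S (S + 1)
  · rw [indicator_of_mem hmem]
    refine ENNReal.ofReal_le_ofReal ?_
    by_cases hxR : x ≤ R + 1
    · rw [min_eq_left hxR]
      exact mul_le_of_le_one_left (Real.exp_nonneg _) (cutoff_le_one R n x)
    · rw [cutoff_eq_zero_of_ge (by nlinarith), zero_mul]
      exact Real.exp_nonneg _
  · have hz : cutoff R n x = 0 := by
      rcases lt_or_ge x S with h | h
      · have : x < R - (n : ℝ)⁻¹ := (lt_max_iff.1 h).resolve_left (not_lt.2 hx0)
        exact cutoff_eq_zero_of_le (by nlinarith)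
      · have h1 : S + 1 ≤ x := not_lt.1 fun h' => hmem ⟨h, h'⟩
        have h2 : R - (n : ℝ)⁻¹ ≤ S := le_max_right _ _
        exact cutoff_eq_zero_of_ge (by nlinarith)
    simp [hz]

/-- `G^β_κ` is closed under weak convergence of measures. -/
theorem MemG.of_tendsto_integral {β κ : ℝ} (hβ : 0 ≤ β) (hκ : 0 ≤ κ) {μ : ℕ → Measure ℝ}
    (hμ : ∀ j, MemG β κ (μ j)) {ν : Measure ℝ} [IsFiniteMeasure ν] (hν : ν (Iio 0) = 0)
    (hlim : ∀ φ : ℝ →ᵇ ℝ, Tendsto (fun j => ∫ x, φ x ∂(μ j)) atTop (𝓝 (∫ x, φ x ∂ν))) :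
    MemG β κ ν := by
  refine ⟨hν, iSup_le fun ⟨R, hR⟩ => ?_⟩
  have hcont : ∀ n : ℕ, Continuous fun x => cutoff R n x * Real.exp (β * min x (R + 1)) :=
    fun n => (continuous_cutoff R n).mul (by fun_prop)
  have hnonneg : ∀ n x, 0 ≤ cutoff R n x * Real.exp (β * min x (R + 1)) :=
    fun n x => mul_nonneg (cutoff_nonneg R n x) (Real.exp_nonneg _)
  have hbound : ∀ n : ℕ, 0 < n →
      ∫⁻ x, ENNReal.ofReal (cutoff R n x * Real.exp (β * min x (R + 1))) ∂ν ≤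
        ENNReal.ofReal κ := by
    intro n hn
    let φ : ℝ →ᵇ ℝ := BoundedContinuousFunction.ofNormedAddCommGroup _ (hcont n)
      (Real.exp (β * (R + 1))) fun x => by
        rw [Real.norm_of_nonneg (hnonneg n x)]
        refine (mul_le_of_le_one_left (Real.exp_nonneg _) (cutoff_le_one R n x)).trans ?_
        gcongr
        exact min_le_right _ _
    have hle : ∫ x, φ x ∂ν ≤ κ := by
      refine le_of_tendsto' (hlim φ) fun j => ?_
      refine (integral_eq_lintegral_of_nonneg_ae (.of_forall (hnonneg n))
        φ.continuous.aestronglyMeasurable).trans_le ?_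
      exact ENNReal.toReal_le_of_le_ofReal hκ ((hμ j).lintegral_cutoff_mul_exp_le hn)
    exact (ofReal_integral_eq_lintegral_ofReal (φ.integrable ν)
      (.of_forall (hnonneg n))).symm.trans_le (ENNReal.ofReal_le_ofReal hle)
  calc ∫⁻ x in Ico R (R + 1), ENNReal.ofReal (Real.exp (β * x)) ∂ν
      ≤ ∫⁻ x in Ico R (R + 1), liminf (fun n : ℕ =>
          ENNReal.ofReal (cutoff R n x * Real.exp (β * min x (R + 1)))) atTop ∂ν := by
        refine setLIntegral_mono' measurableSet_Ico fun x hx => ?_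
        refine le_of_eq (Tendsto.liminf_eq ?_).symm
        refine tendsto_const_nhds.congr' ?_
        filter_upwards [eventually_cutoff_eq_one hx] with n hn
        rw [hn, one_mul, min_eq_left hx.2.le]
    _ ≤ liminf (fun n : ℕ => ∫⁻ x in Ico R (R + 1),
          ENNReal.ofReal (cutoff R n x * Real.exp (β * min x (R + 1))) ∂ν) atTop :=
        lintegral_liminf_le fun n => (hcont n).measurable.ennreal_ofReal
    _ ≤ ENNReal.ofReal κ := by
        refine liminf_le_of_le (by isBoundedDefault) fun b hb => ?_
        obtain ⟨n, hbn, hn⟩ := (hb.and (eventually_gt_atTop 0)).exists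
        exact hbn.trans ((setLIntegral_le_lintegral _ _).trans (hbound n hn))

/-- `G^β_κ` is weakly sequentially compact: every sequence in `G^β_κ`
has a subsequence converging weakly (testing against all bounded continuous functions)
to a limit measure which again belongs to `G^β_κ`. -/
theorem G_weakly_sequentially_compact
    (β κ : ℝ) (hβ : 0 < β) (hκ : 0 < κ)
    (μ : ℕ → Measure ℝ) (hμ : ∀ j, MemG β κ (μ j)) :
    ∃ (ν : Measure ℝ) (g : ℕ → ℕ), StrictMono g ∧ MemG β κ ν ∧
      ∀ φ : BoundedContinuousFunction ℝ ℝ,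
        Tendsto (fun n => ∫ x, φ x ∂(μ (g n))) atTop (𝓝 (∫ x, φ x ∂ν)) := by
  set q : ℝ≥0 := ⟨Real.exp (-β), Real.exp_nonneg _⟩
  have hq : ENNReal.ofReal (Real.exp (-β)) = q := ENNReal.ofReal_eq_coe_nnreal _
  have hq1 : q < 1 := Real.exp_lt_one_iff.2 (neg_lt_zero.2 hβ)
  have hC : 0 < κ.toNNReal * (1 - q)⁻¹ :=
    mul_pos (Real.toNNReal_pos.2 hκ) (inv_pos.2 (tsub_pos_of_lt hq1))
  have htail : ∀ j (n : ℕ), μ j (Ici (n : ℝ)) ≤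
      (κ.toNNReal * (1 - q)⁻¹ : ℝ≥0) * (q ^ n : ℝ≥0) := by
    intro j n
    convert (hμ j).measure_Ici_le hβ.le n using 2
    · rw [hq, ENNReal.coe_mul, ENNReal.coe_inv (tsub_pos_of_lt hq1).ne', ENNReal.coe_sub]
      rfl
    · rw [hq, ENNReal.coe_pow]
  have hmass : ∀ j, μ j univ ≤ (κ.toNNReal * (1 - q)⁻¹ : ℝ≥0) := by
    intro j
    rw [← Iio_union_Ici (a := (0 : ℝ))]
    refine (measure_union_le _ _).trans ?_
    rw [(hμ j).1, zero_add]
    simpa using htail j 0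
  obtain ⟨ν, g, hg, hfin, hν, hlim⟩ := exists_subseq_tendsto_integral_of_measure_Ici_le hC
    (NNReal.tendsto_pow_atTop_nhds_zero_of_lt_one hq1) (fun j => (hμ j).1) hmass htail
  exact ⟨ν, g, hg, MemG.of_tendsto_integral hβ.le hκ.le (fun j => hμ (g j)) hν hlim, hlim⟩
end
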